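/- Let (T_i)_{i≥0} be a sequence of pairwise distinct (non-isomorphic) trees in 𝒯₃, where T_i has n_i vertices, l_i leaves, and t_i twigs. Then D(T_i) → 3/4 as i → ∞ if and only if l_i/n_i → 1/2 and t_i/n_i → 0 as i → ∞. -/

import Mathlib

open SimpleGraph Finset BigOperators Filter

attribute [local instance] Classical.propDecidable

/-- A finset of vertices induces a subtree of `G`: it is nonempty and its induced
subgraph is connected. -/
def SimpleGraph.IsSubtree {V : Type*} (G : SimpleGraph V) (s : Finset V) : Prop :=
  s.Nonempty ∧ (G.induce (s : Set V)).Connected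

/-- The collection of all subtrees of `G` (as finsets of vertices). -/
noncomputable def subtreeFinset {V : Type*} [Fintype V] (G : SimpleGraph V) :
    Finset (Finset V) :=
  Finset.univ.filter G.IsSubtree

/-- `μ(G)`: the average order (number of vertices) of a subtree of `G`. -/
noncomputable def mu {V : Type*} [Fintype V] (G : SimpleGraph V) : ℚ :=
  (∑ s ∈ subtreeFinset G, (s.card : ℚ)) / ((subtreeFinset G).card : ℚ)

/-- The number of leaves (vertices of degree one) of `G`. -/
noncomputable def numLeaves {V : Type*} [Fintype V] (G : SimpleGraph V) : ℕ :=
  (Finset.univ.filter (fun v => G.degree v = 1)).card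

/-- `G` is in the class 𝒯₃: a tree with at least one internal vertex (a vertex of
degree at least 2) in which every internal vertex has degree at least 3. -/
noncomputable def InT3 {V : Type*} [Fintype V] (G : SimpleGraph V) : Prop :=
  G.IsTree ∧ (∃ v, 2 ≤ G.degree v) ∧ ∀ v, 2 ≤ G.degree v → 3 ≤ G.degree v

/-- `v` is a twig of `G`: it has degree at least 2 and at least `deg(v) - 1` of its
neighbours are leaves. -/
noncomputable def IsTwig {V : Type*} [Fintype V] (G : SimpleGraph V) (v : V) : Prop :=
  2 ≤ G.degree v ∧
    G.degree v - 1 ≤ ((G.neighborFinset v).filter (fun u => G.degree u = 1)).card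

/-- The number of twigs of `G`. -/
noncomputable def numTwigs {V : Type*} [Fintype V] (G : SimpleGraph V) : ℕ :=
  (Finset.univ.filter (fun v => IsTwig G v)).card

section Tree

variable {V : Type*} {G : SimpleGraph V}

theorem exists_parent (hG : G.IsTree) {x z : V} (h : z ≠ x) :
    ∃ p, G.Adj p z ∧ G.dist x z = G.dist x p + 1 := by
  obtain ⟨q, hq⟩ := hG.connected.exists_walk_length_eq_dist z x
  cases q with
  | nil => exact absurd rfl h
  | cons hadj q =>
    rename_i p
    refine ⟨p, hadj.symm, ?_⟩
    have h1 := G.dist_le q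
    rw [Walk.length_cons] at hq
    rcases hG.dist_eq_dist_add_one_of_adj x hadj with h2 | h2
    · exact h2
    · rw [dist_comm] at hq h1
      grind [SimpleGraph.dist_comm]

theorem parent_eq_penultimate (hG : G.IsTree) {x z p : V} (hadj : G.Adj p z)
    (hd : G.dist x z = G.dist x p + 1) {q : G.Walk x z} (hq : q.IsPath) :
    p = q.penultimate := by
  obtain ⟨a, ha⟩ := hG.connected.exists_walk_length_eq_dist x p
  have hb : (a.concat hadj).IsPath := by
    apply Walk.isPath_of_length_eq_dist
    rw [Walk.length_concat, ha, hd]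
  rw [(hG.existsUnique_path x z).unique hq hb, Walk.penultimate_concat]

theorem parent_unique (hG : G.IsTree) {x z p p' : V} (h : G.Adj p z)
    (hd : G.dist x z = G.dist x p + 1) (h' : G.Adj p' z)
    (hd' : G.dist x z = G.dist x p' + 1) : p = p' := by
  obtain ⟨q, hq, -⟩ := hG.connected.exists_path_of_dist x z
  rw [parent_eq_penultimate hG h hd hq, parent_eq_penultimate hG h' hd' hq]

theorem SimpleGraph.IsSubtree.parent_mem (hG : G.IsTree) {S : Finset V} (hS : G.IsSubtree S)
    {x z p : V} (hx : x ∈ S) (hz : z ∈ S) (h : G.Adj p z)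
    (hd : G.dist x z = G.dist x p + 1) : p ∈ S := by
  obtain ⟨q, hq, -⟩ := hS.2.exists_path_of_dist ⟨x, by simpa using hx⟩ ⟨z, by simpa using hz⟩
  have h1 := parent_eq_penultimate hG h hd
    (hq.map (f := (Embedding.induce (G := G) (S : Set V)).toHom) Subtype.val_injective)
  have h2 : p ∈ (q.map (Embedding.induce (G := G) (S : Set V)).toHom).support := by
    rw [h1]; exact Walk.getVert_mem_support _ _
  rw [Walk.support_map, List.mem_map] at h2
  obtain ⟨⟨a, ha⟩, -, rfl⟩ := h2
  simpa using ha

theorem isSubtree_of_forall_exists_parent {S : Finset V} {x : V} (hx : x ∈ S)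
    (h : ∀ z ∈ S, z ≠ x → ∃ p ∈ S, G.Adj p z ∧ G.dist x z = G.dist x p + 1) :
    G.IsSubtree S := by
  refine ⟨⟨x, hx⟩, ?_⟩
  have key : ∀ n, ∀ z (hz : z ∈ S), G.dist x z = n →
      (G.induce (S : Set V)).Reachable ⟨x, by simpa using hx⟩ ⟨z, by simpa using hz⟩ := by
    intro n
    induction n with
    | zero =>
      intro z hz hn
      by_cases hzx : z = x
      · subst hzx; rfl
      · obtain ⟨p, -, -, hd⟩ := h z hz hzx
        omega
    | succ n ih =>
      intro z hz hn
      by_cases hzx : z = x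
      · subst hzx; rfl
      · obtain ⟨p, hp, hadj, hd⟩ := h z hz hzx
        refine (ih p hp (by omega)).trans (Adj.reachable ?_)
        simpa using hadj
  rw [connected_iff_exists_forall_reachable]
  exact ⟨⟨x, by simpa using hx⟩, fun ⟨z, hz⟩ => key _ z (by simpa using hz) rfl⟩

theorem isSubtree_singleton (v : V) : G.IsSubtree {v} :=
  isSubtree_of_forall_exists_parent (mem_singleton_self v)
    fun _ hz hzv => absurd (mem_singleton.1 hz) hzv

/-- The vertices of a tree on the `y`-side of the edge `xy`. -/
noncomputable def branch [Fintype V] (G : SimpleGraph V) (x y : V) : Finset V :=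
  univ.filter fun z => G.dist z y < G.dist z x

variable [Fintype V]

theorem mem_branch {x y z : V} : z ∈ branch G x y ↔ G.dist z y < G.dist z x := by
  simp [branch]

theorem mem_branch_iff (hG : G.IsTree) {x y z : V} (hxy : G.Adj x y) :
    z ∈ branch G x y ↔ G.dist x z = G.dist y z + 1 := by
  rw [mem_branch, dist_comm (u := x), dist_comm (u := y)]
  have := hG.dist_eq_dist_add_one_of_adj z hxy
  omega

theorem not_mem_branch_iff (hG : G.IsTree) {x y z : V} (hxy : G.Adj x y) :
    z ∉ branch G x y ↔ z ∈ branch G y x := by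
  rw [mem_branch_iff hG hxy, mem_branch_iff hG hxy.symm, dist_comm (u := x), dist_comm (u := y)]
  have := hG.dist_eq_dist_add_one_of_adj z hxy
  omega

theorem right_mem_branch {x y : V} (hxy : G.Adj x y) : y ∈ branch G x y := by
  rw [mem_branch, dist_self, dist_comm, dist_eq_one_iff_adj.2 hxy]; exact one_pos

theorem left_notMem_branch {x y : V} : x ∉ branch G x y := by
  rw [mem_branch, dist_self]; exact Nat.not_lt_zero _

theorem exists_parent_mem_branch (hG : G.IsTree) {x y z : V} (hxy : G.Adj x y)
    (hz : z ∈ branch G x y) (hzy : z ≠ y) :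
    ∃ p ∈ branch G x y, G.Adj p z ∧ G.dist x z = G.dist x p + 1 ∧
      G.dist y z = G.dist y p + 1 := by
  obtain ⟨p, hp, hd⟩ := exists_parent hG hzy
  rw [mem_branch_iff hG hxy] at hz
  have h1 := hG.dist_eq_dist_add_one_of_adj x hp
  have h2 := hG.dist_eq_dist_add_one_of_adj p hxy
  rw [dist_comm (u := p), dist_comm (u := p)] at h2
  refine ⟨p, (mem_branch_iff hG hxy).2 ?_, hp, ?_, hd⟩ <;> omega

theorem child_mem_branch (hG : G.IsTree) {x y z c : V} (hxy : G.Adj x y)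
    (hz : z ∈ branch G x y) (hc : G.Adj z c) (hd : G.dist x c = G.dist x z + 1) :
    c ∈ branch G x y := by
  rw [mem_branch_iff hG hxy] at hz ⊢
  have h1 := hG.dist_eq_dist_add_one_of_adj y hc
  have h2 := hG.dist_eq_dist_add_one_of_adj c hxy
  rw [dist_comm (u := c), dist_comm (u := c)] at h2
  omega

theorem SimpleGraph.IsSubtree.disjoint_branch (hG : G.IsTree) {S : Finset V} (hS : G.IsSubtree S)
    {x y : V} (hxy : G.Adj x y) (hx : x ∈ S) (hy : y ∉ S) : Disjoint S (branch G x y) := by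
  rw [Finset.disjoint_left]
  intro z
  induction hn : G.dist y z generalizing z with
  | zero =>
    rw [hG.connected.dist_eq_zero_iff] at hn
    exact fun h => absurd (hn ▸ h) hy
  | succ n ih =>
    intro hz hzB
    have hzy : z ≠ y := fun h => hy (h ▸ hz)
    obtain ⟨p, hpB, hadj, hd, hd'⟩ := exists_parent_mem_branch hG hxy hzB hzy
    exact ih (by omega) (hS.parent_mem hG hx hz hadj hd) hpB

end Tree

section Branch

variable {V : Type*} [Fintype V] {G : SimpleGraph V}

/-- The leaves of `G`. -/
noncomputable def leafFinset (G : SimpleGraph V) : Finset V :=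
  univ.filter fun v => G.degree v = 1

/-- The vertices of `G` that are not leaves. -/
noncomputable def internalFinset (G : SimpleGraph V) : Finset V :=
  univ.filter fun v => G.degree v ≠ 1

theorem mem_leafFinset {v : V} : v ∈ leafFinset G ↔ G.degree v = 1 := by simp [leafFinset]

theorem mem_internalFinset {v : V} : v ∈ internalFinset G ↔ G.degree v ≠ 1 := by
  simp [internalFinset]

theorem eq_of_adj_leaf {v a b : V} (hv : G.degree v = 1) (ha : G.Adj v a) (hb : G.Adj v b) :
    a = b :=
  (G.degree_eq_one_iff_existsUnique_adj.1 hv).unique ha hb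

theorem two_le_card_children (hG : G.IsTree) {z : V} (hz : 3 ≤ G.degree z) (x : V) :
    2 ≤ (univ.filter fun c => G.Adj z c ∧ G.dist x c = G.dist x z + 1).card := by
  have h1 : (univ.filter fun c => G.Adj z c ∧ G.dist x z = G.dist x c + 1).card ≤ 1 := by
    rw [card_le_one]
    simp only [mem_filter, mem_univ, true_and]
    exact fun a ha b hb => parent_unique hG ha.1.symm ha.2 hb.1.symm hb.2
  have h2 : G.neighborFinset z ⊆ (univ.filter fun c => G.Adj z c ∧ G.dist x z = G.dist x c + 1) ∪
      (univ.filter fun c => G.Adj z c ∧ G.dist x c = G.dist x z + 1) := by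
    intro c hc
    rw [mem_neighborFinset] at hc
    have := hG.dist_eq_dist_add_one_of_adj x hc
    simp [hc, this]
  have h3 := (card_le_card h2).trans (card_union_le _ _)
  rw [card_neighborFinset_eq_degree] at h3
  omega

theorem card_internal_branch_le (hG : G.IsTree) (hdeg : ∀ v, G.degree v = 1 ∨ 3 ≤ G.degree v)
    {x y : V} (hxy : G.Adj x y) :
    (internalFinset G ∩ branch G x y).card ≤ (leafFinset G ∩ branch G x y).card := by
  have h1 : ((internalFinset G ∩ branch G x y).biUnion fun z =>
      univ.filter fun c => G.Adj z c ∧ G.dist x c = G.dist x z + 1) ⊆ branch G x y := by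
    intro c
    simp only [mem_biUnion, mem_inter, mem_filter, mem_univ, true_and]
    rintro ⟨z, ⟨-, hz⟩, hc, hd⟩
    exact child_mem_branch hG hxy hz hc hd
  have h2 := card_le_card h1
  rw [card_biUnion] at h2
  · have h3 : ∑ z ∈ internalFinset G ∩ branch G x y, 2 ≤ ∑ z ∈ internalFinset G ∩ branch G x y,
        (univ.filter fun c => G.Adj z c ∧ G.dist x c = G.dist x z + 1).card := by
      refine sum_le_sum fun z hz => two_le_card_children hG ?_ x
      have := mem_internalFinset.1 (mem_inter.1 hz).1
      have := hdeg z
      omega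
    have h4 : branch G x y ⊆ (internalFinset G ∩ branch G x y) ∪ (leafFinset G ∩ branch G x y) := by
      intro z hz
      simp only [mem_union, mem_inter, mem_internalFinset, mem_leafFinset, hz, and_true]
      tauto
    have h5 := (card_le_card h4).trans (card_union_le _ _)
    rw [sum_const, smul_eq_mul] at h3
    omega
  · intro a _ b _ hab
    rw [Function.onFun, Finset.disjoint_left]
    simp only [mem_filter, mem_univ, true_and]
    exact fun c hc hc' => hab (parent_unique hG hc.1 hc.2 hc'.1 hc'.2)

theorem mem_subtreeFinset {S : Finset V} : S ∈ subtreeFinset G ↔ G.IsSubtree S := by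
  simp [subtreeFinset]

theorem isSubtree_extend (hG : G.IsTree) {x y : V} (hxy : G.Adj x y) {S R : Finset V}
    (hS : G.IsSubtree S) (hx : x ∈ S) (hy : y ∈ R) (hR : R ⊆ branch G x y)
    (hI : internalFinset G ∩ branch G x y ⊆ R) : G.IsSubtree (S ∪ R) := by
  refine isSubtree_of_forall_exists_parent (mem_union_left _ hx) fun z hz hzx => ?_
  rcases mem_union.1 hz with hz | hz
  · obtain ⟨p, hp, hd⟩ := exists_parent hG hzx
    exact ⟨p, mem_union_left _ (hS.parent_mem hG hx hz hp hd), hp, hd⟩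
  · by_cases hzy : z = y
    · subst hzy
      exact ⟨x, mem_union_left _ hx, hxy, by rw [dist_self, dist_eq_one_iff_adj.2 hxy]⟩
    · obtain ⟨p, hp, hadj, hd, -⟩ := exists_parent_mem_branch hG hxy (hR hz) hzy
      refine ⟨p, mem_union_right _ (hI (mem_inter.2 ⟨mem_internalFinset.2 fun h => ?_, hp⟩)),
        hadj, hd⟩
      obtain ⟨q, hq, hqd⟩ := exists_parent hG (x := x) (z := p)
        fun h => left_notMem_branch (h ▸ hp)
      have := eq_of_adj_leaf h hadj hq.symm
      subst this
      omega

/-- Subtrees that contain `x` but not `y`. -/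
noncomputable def cutFinset (G : SimpleGraph V) (x y : V) : Finset (Finset V) :=
  (subtreeFinset G).filter fun S => x ∈ S ∧ y ∉ S

theorem card_cutFinset_mul_le (hG : G.IsTree) (hdeg : ∀ v, G.degree v = 1 ∨ 3 ≤ G.degree v)
    {x y : V} (hxy : G.Adj x y) (hy : y ∈ internalFinset G) :
    (cutFinset G x y).card * 2 ^ (internalFinset G ∩ branch G x y).card ≤
      (subtreeFinset G).card := by
  have h1 : (cutFinset G x y ×ˢ (leafFinset G ∩ branch G x y).powerset).card ≤
      (subtreeFinset G).card := by
    refine card_le_card_of_injOn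
      (fun A => A.1 ∪ ((internalFinset G ∩ branch G x y) ∪ A.2)) ?_ ?_
    · rintro ⟨S, L⟩ hA
      simp only [cutFinset, coe_product, Set.mem_prod, mem_coe, mem_filter, mem_powerset,
        mem_subtreeFinset] at hA ⊢
      refine isSubtree_extend hG hxy hA.1.1 hA.1.2.1 ?_ ?_ ?_
      · exact mem_union_left _ (mem_inter.2 ⟨hy, right_mem_branch hxy⟩)
      · exact union_subset inter_subset_right (hA.2.trans inter_subset_right)
      · exact subset_union_left
    · rintro ⟨S, L⟩ hA ⟨S', L'⟩ hA' heq
      simp only [cutFinset, coe_product, Set.mem_prod, mem_coe, mem_filter, mem_powerset,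
        mem_subtreeFinset] at hA hA' heq
      have hS := Finset.disjoint_left.1 (hA.1.1.disjoint_branch hG hxy hA.1.2.1 hA.1.2.2)
      have hS' := Finset.disjoint_left.1 (hA'.1.1.disjoint_branch hG hxy hA'.1.2.1 hA'.1.2.2)
      have key : ∀ a, (a ∈ S ∪ ((internalFinset G ∩ branch G x y) ∪ L)) ↔
        a ∈ S' ∪ ((internalFinset G ∩ branch G x y) ∪ L') := fun a => by rw [heq]
      simp only [mem_union, mem_inter, mem_internalFinset] at key
      have hL : ∀ a ∈ L, G.degree a = 1 ∧ a ∈ branch G x y := fun a ha => by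
        simpa [mem_leafFinset] using hA.2 ha
      have hL' : ∀ a ∈ L', G.degree a = 1 ∧ a ∈ branch G x y := fun a ha => by
        simpa [mem_leafFinset] using hA'.2 ha
      rw [Prod.mk.injEq]
      constructor <;> ext a <;> have := key a <;> have := @hS a <;> have := @hS' a <;>
        have := hL a <;> have := hL' a <;> tauto
  rw [card_product, card_powerset] at h1
  exact (Nat.mul_le_mul_left _ (Nat.pow_le_pow_right two_pos
    (card_internal_branch_le hG hdeg hxy))).trans h1

theorem exists_twig_mem_branch (hG : G.IsTree) (hdeg : ∀ v, G.degree v = 1 ∨ 3 ≤ G.degree v)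
    {x y : V} (hxy : G.Adj x y) (hy : y ∈ internalFinset G) :
    ∃ w ∈ branch G x y, IsTwig G w := by
  obtain ⟨w, hw, hmax⟩ := exists_max_image (internalFinset G ∩ branch G x y) (G.dist x)
    ⟨y, mem_inter.2 ⟨hy, right_mem_branch hxy⟩⟩
  obtain ⟨hwI, hwB⟩ := mem_inter.1 hw
  refine ⟨w, hwB, ?_, ?_⟩
  · have := mem_internalFinset.1 hwI
    have := hdeg w
    omega
  · obtain ⟨p, hp, hd⟩ := exists_parent hG (x := x) (z := w)
      fun h => left_notMem_branch (h ▸ hwB)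
    have h1 : (G.neighborFinset w).erase p ⊆
        (G.neighborFinset w).filter (fun u => G.degree u = 1) := by
      intro c hc
      obtain ⟨hcp, hc⟩ := mem_erase.1 hc
      refine mem_filter.2 ⟨hc, ?_⟩
      rw [mem_neighborFinset] at hc
      have h2 : G.dist x c = G.dist x w + 1 := by
        rcases hG.dist_eq_dist_add_one_of_adj x hc with h | h
        · exact absurd (parent_unique hG hc.symm h hp hd) hcp
        · exact h
      by_contra h3
      have := hmax c (mem_inter.2 ⟨mem_internalFinset.2 h3, child_mem_branch hG hxy hwB hc h2⟩)
      omega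
    have h2 := card_le_card h1
    rwa [card_erase_of_mem (by simpa using hp.symm), card_neighborFinset_eq_degree] at h2

end Branch

section Cut

variable {V : Type*} [Fintype V] {G : SimpleGraph V}

theorem mem_branch_iff_dist_root (hG : G.IsTree) {r x y b : V} (hxy : G.Adj x y)
    (hr : G.dist r y = G.dist r x + 1) :
    b ∈ branch G x y ↔ G.dist r b = G.dist r y + G.dist y b := by
  constructor
  · induction hn : G.dist y b using Nat.strong_induction_on generalizing b with
    | _ n ih =>
    intro hb
    by_cases hby : b = y
    · subst hby
      rw [dist_self] at hn
      omega
    · obtain ⟨p, hp, hadj, -, hd⟩ := exists_parent_mem_branch hG hxy hb hby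
      have h1 := ih _ (by omega) rfl hp
      rcases hG.dist_eq_dist_add_one_of_adj r hadj with h2 | h2
      · exfalso
        by_cases hpy : p = y
        · subst hpy
          have := parent_unique hG hadj.symm h2 hxy hr
          subst this
          exact left_notMem_branch hb
        · obtain ⟨q, hq, hqadj, -, hqd⟩ := exists_parent_mem_branch hG hxy hp hpy
          have h3 := ih _ (by omega) rfl hq
          have := parent_unique hG hadj.symm h2 hqadj (by omega)
          subst this
          omega
      · omega
  · intro h
    by_contra hb
    rw [not_mem_branch_iff hG hxy, mem_branch_iff hG hxy.symm] at hb
    have := hG.connected.dist_triangle (u := r) (v := x) (w := b)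
    omega

theorem branch_subset_branch (hG : G.IsTree) {r x y x' y' w : V} (hxy : G.Adj x y)
    (hr : G.dist r y = G.dist r x + 1) (hxy' : G.Adj x' y') (hr' : G.dist r y' = G.dist r x' + 1)
    (hle : G.dist r y ≤ G.dist r y') (hw : w ∈ branch G x y) (hw' : w ∈ branch G x' y') :
    branch G x' y' ⊆ branch G x y := by
  have key : y' ∈ branch G x y := by
    induction hn : G.dist y' w generalizing w with
    | zero =>
      rw [hG.connected.dist_eq_zero_iff] at hn
      exact hn ▸ hw
    | succ n ih =>
      have hne : w ≠ y' := by
        rintro rfl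
        rw [dist_self] at hn
        omega
      obtain ⟨p, hp, hadj, -, hd⟩ := exists_parent_mem_branch hG hxy' hw' hne
      have h1 := (mem_branch_iff_dist_root hG hxy' hr').1 hw'
      have h2 := (mem_branch_iff_dist_root hG hxy' hr').1 hp
      by_cases hwy : w = y
      · subst hwy
        omega
      · obtain ⟨q, hq, hqadj, -, hqd⟩ := exists_parent_mem_branch hG hxy hw hwy
        have h3 := (mem_branch_iff_dist_root hG hxy hr).1 hw
        have h4 := (mem_branch_iff_dist_root hG hxy hr).1 hq
        have := parent_unique hG (x := r) hadj (by omega) hqadj (by omega)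
        subst this
        exact ih hq hp (by omega)
  intro b hb
  rw [mem_branch_iff_dist_root hG hxy hr] at key ⊢
  rw [mem_branch_iff_dist_root hG hxy' hr'] at hb
  have h1 := hG.connected.dist_triangle (u := y) (v := y') (w := b)
  have h2 := hG.connected.dist_triangle (u := r) (v := y) (w := b)
  omega

theorem eq_of_card_internal_branch_eq (hG : G.IsTree) {r x y x' y' w : V} (hxy : G.Adj x y)
    (hr : G.dist r y = G.dist r x + 1) (hxy' : G.Adj x' y') (hr' : G.dist r y' = G.dist r x' + 1)
    (hle : G.dist r y ≤ G.dist r y') (hw : w ∈ branch G x y) (hw' : w ∈ branch G x' y')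
    (hy : y ∈ internalFinset G)
    (hcard : (internalFinset G ∩ branch G x y).card = (internalFinset G ∩ branch G x' y').card) :
    x = x' ∧ y = y' := by
  have hsub := branch_subset_branch hG hxy hr hxy' hr' hle hw hw'
  have heq := eq_of_subset_of_card_le (inter_subset_inter_left hsub)
    hcard.le
  have h1 : y ∈ internalFinset G ∩ branch G x' y' :=
    heq ▸ mem_inter.2 ⟨hy, right_mem_branch hxy⟩
  have h2 := (mem_branch_iff_dist_root hG hxy' hr').1 (mem_inter.1 h1).2
  have h3 : y' = y := (hG.connected.dist_eq_zero_iff).1 (by omega)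
  subst h3
  exact ⟨parent_unique hG hxy hr hxy' hr', rfl⟩

/-- Ordered pairs of adjacent internal vertices. -/
noncomputable def internalDarts (G : SimpleGraph V) : Finset (V × V) :=
  univ.filter fun e => G.Adj e.1 e.2 ∧ e.1 ∈ internalFinset G ∧ e.2 ∈ internalFinset G

theorem card_away_le (hG : G.IsTree) (hdeg : ∀ v, G.degree v = 1 ∨ 3 ≤ G.degree v) (r : V)
    (m : ℕ) :
    ((internalDarts G).filter fun e => G.dist r e.2 = G.dist r e.1 + 1 ∧
      (internalFinset G ∩ branch G e.1 e.2).card = m).card ≤ numTwigs G := by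
  have : Nonempty V := ⟨r⟩
  choose! f hfB hfT using fun (e : V × V) (he : e ∈ internalDarts G) =>
    exists_twig_mem_branch hG hdeg (mem_filter.1 he).2.1 (mem_filter.1 he).2.2.2
  refine card_le_card_of_injOn f ?_ ?_
  · intro e he
    simp only [coe_filter, Set.mem_ofPred_eq, mem_univ, true_and] at he ⊢
    exact hfT e he.1
  · rintro ⟨x, y⟩ he ⟨x', y'⟩ he' heq
    simp only [coe_filter, Set.mem_ofPred_eq] at he he'
    have hw := hfB _ he.1
    have hw' := hfB _ he'.1
    rw [heq] at hw
    obtain ⟨h1, h2, h3⟩ := he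
    obtain ⟨h1', h2', h3'⟩ := he'
    simp only [internalDarts, mem_filter, mem_univ, true_and] at h1 h1'
    rw [Prod.mk.injEq]
    rcases le_total (G.dist r y) (G.dist r y') with hle | hle
    · exact eq_of_card_internal_branch_eq hG h1.1 h2 h1'.1 h2' hle hw hw' h1.2.2 (h3.trans h3'.symm)
    · have := eq_of_card_internal_branch_eq hG h1'.1 h2' h1.1 h2 hle hw' hw h1'.2.2
        (h3'.trans h3.symm)
      exact ⟨this.1.symm, this.2.symm⟩

theorem card_branch_add_card_branch (hG : G.IsTree) {x y : V} (hxy : G.Adj x y) :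
    (internalFinset G ∩ branch G x y).card + (internalFinset G ∩ branch G y x).card =
      (internalFinset G).card := by
  have h : internalFinset G ∩ branch G y x = internalFinset G \ branch G x y := by
    ext z
    rw [mem_inter, Finset.mem_sdiff, not_mem_branch_iff hG hxy]
  rw [h, card_inter_add_card_sdiff]

theorem card_darts_le (hG : G.IsTree) (hdeg : ∀ v, G.degree v = 1 ∨ 3 ≤ G.degree v) (m : ℕ) :
    ((internalDarts G).filter fun e => (internalFinset G ∩ branch G e.1 e.2).card = m).card ≤
      2 * numTwigs G := by
  obtain ⟨r⟩ := hG.connected.nonempty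
  have h1 := card_away_le hG hdeg r m
  have h2 := card_away_le hG hdeg r ((internalFinset G).card - m)
  have h3 : ((internalDarts G).filter fun e => G.dist r e.1 = G.dist r e.2 + 1 ∧
      (internalFinset G ∩ branch G e.1 e.2).card = m).card ≤
      ((internalDarts G).filter fun e => G.dist r e.2 = G.dist r e.1 + 1 ∧
      (internalFinset G ∩ branch G e.1 e.2).card = (internalFinset G).card - m).card := by
    refine card_le_card_of_injOn Prod.swap ?_ Prod.swap_injective.injOn
    rintro ⟨x, y⟩ he
    simp only [internalDarts, coe_filter, Set.mem_ofPred_eq, mem_filter, mem_univ, true_and,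
      Prod.swap_prod_mk] at he ⊢
    have := card_branch_add_card_branch hG he.1.1
    exact ⟨⟨he.1.1.symm, he.1.2.2, he.1.2.1⟩, he.2.1, by omega⟩
  have h4 : ((internalDarts G).filter fun e => (internalFinset G ∩ branch G e.1 e.2).card = m) ⊆
      ((internalDarts G).filter fun e => G.dist r e.2 = G.dist r e.1 + 1 ∧
        (internalFinset G ∩ branch G e.1 e.2).card = m) ∪
      ((internalDarts G).filter fun e => G.dist r e.1 = G.dist r e.2 + 1 ∧
        (internalFinset G ∩ branch G e.1 e.2).card = m) := by
    rintro ⟨x, y⟩ he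
    obtain ⟨he, hm⟩ := mem_filter.1 he
    have := hG.dist_eq_dist_add_one_of_adj r (mem_filter.1 he).2.1
    simp only [mem_union, mem_filter, he, true_and]
    dsimp only at *
    tauto
  have h5 := (card_le_card h4).trans (card_union_le _ _)
  omega

theorem exists_cut (hG : G.IsTree) {S : Finset V} (hS : G.IsSubtree S)
    (hleaf : ∀ a, G.degree a = 1 → S ≠ {a}) {v : V} (hv : v ∈ internalFinset G) (hvS : v ∉ S) :
    ∃ e ∈ internalDarts G, (e.1 ∈ S ∧ e.2 ∉ S) ∧ v ∈ branch G e.1 e.2 := by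
  obtain ⟨x, hx, hmin⟩ := exists_min_image S (G.dist v) hS.1
  obtain ⟨y, hyx, hd⟩ := exists_parent hG (x := v) (z := x) fun h => hvS (h ▸ hx)
  have hyS : y ∉ S := fun h => by
    have := hmin y h
    omega
  have hvB : v ∈ branch G x y := by
    rw [mem_branch]
    omega
  refine ⟨(x, y), ?_, ⟨hx, hyS⟩, hvB⟩
  simp only [internalDarts, mem_filter, mem_univ, true_and]
  refine ⟨hyx.symm, mem_internalFinset.2 fun h => ?_, mem_internalFinset.2 fun h => ?_⟩
  · apply hleaf x h
    rw [eq_singleton_iff_unique_mem]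
    refine ⟨hx, fun s hs => ?_⟩
    by_contra hsx
    obtain ⟨p, hp, hpd⟩ := exists_parent hG (x := s) (z := x) fun h => hsx h.symm
    have hpS := hS.parent_mem hG hs hx hp hpd
    rw [eq_of_adj_leaf h hp.symm hyx.symm] at hpS
    exact hyS hpS
  · have hyv : y ≠ v := by
      rintro rfl
      exact mem_internalFinset.1 hv h
    obtain ⟨p, hp, hpd⟩ := exists_parent hG hyv
    have := eq_of_adj_leaf h hp.symm hyx
    subst this
    omega

theorem sum_range_div_two_pow (k : ℕ) :
    ∑ m ∈ range k, (m : ℚ) / 2 ^ m = 2 - 2 * (k + 1) / 2 ^ k := by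
  induction k with
  | zero => norm_num
  | succ k ih =>
    rw [sum_range_succ, ih]
    push_cast
    field_simp
    ring

theorem sum_card_internal_sdiff_le (hG : G.IsTree)
    (hdeg : ∀ v, G.degree v = 1 ∨ 3 ≤ G.degree v) :
    ∑ S ∈ (subtreeFinset G).filter (fun S => ∀ a, G.degree a = 1 → S ≠ {a}),
        ((internalFinset G \ S).card : ℚ) ≤
      4 * numTwigs G * (subtreeFinset G).card := by
  set N := (subtreeFinset G).card
  set m : V × V → ℕ := fun e => (internalFinset G ∩ branch G e.1 e.2).card with hm
  calc _ ≤ ∑ S ∈ (subtreeFinset G).filter (fun S => ∀ a, G.degree a = 1 → S ≠ {a}),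
        ∑ e ∈ internalDarts G, if e.1 ∈ S ∧ e.2 ∉ S then (m e : ℚ) else 0 := by
        refine sum_le_sum fun S hS => ?_
        obtain ⟨hS, hleaf⟩ := mem_filter.1 hS
        rw [mem_subtreeFinset] at hS
        rw [← sum_filter]
        have h1 : internalFinset G \ S ⊆
            ((internalDarts G).filter fun e => e.1 ∈ S ∧ e.2 ∉ S).biUnion
              fun e => internalFinset G ∩ branch G e.1 e.2 := by
          intro v hv
          obtain ⟨hv, hvS⟩ := mem_sdiff.1 hv
          obtain ⟨e, he, heS, hve⟩ := exists_cut hG hS hleaf hv hvS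
          exact mem_biUnion.2 ⟨e, mem_filter.2 ⟨he, heS⟩, mem_inter.2 ⟨hv, hve⟩⟩
        exact_mod_cast (card_le_card h1).trans card_biUnion_le
    _ ≤ ∑ S ∈ subtreeFinset G,
        ∑ e ∈ internalDarts G, if e.1 ∈ S ∧ e.2 ∉ S then (m e : ℚ) else 0 := by
        refine sum_le_sum_of_subset_of_nonneg (filter_subset _ _) fun S _ _ =>
          sum_nonneg fun e _ => ?_
        split_ifs <;> positivity
    _ = ∑ e ∈ internalDarts G, ((cutFinset G e.1 e.2).card : ℚ) * m e := by
        rw [sum_comm]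
        refine sum_congr rfl fun e _ => ?_
        rw [← sum_filter, sum_const, nsmul_eq_mul]
        rfl
    _ ≤ ∑ e ∈ internalDarts G, (N : ℚ) * (m e / 2 ^ m e) := by
        refine sum_le_sum fun e he => ?_
        have h1 := card_cutFinset_mul_le hG hdeg (mem_filter.1 he).2.1 (mem_filter.1 he).2.2.2
        have h2 : ((cutFinset G e.1 e.2).card : ℚ) * 2 ^ m e ≤ N := by exact_mod_cast h1
        rw [← mul_div_assoc, le_div_iff₀ (by positivity)]
        nlinarith [(Nat.cast_nonneg (m e) : (0 : ℚ) ≤ m e)]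
    _ = ∑ j ∈ range (Fintype.card V + 1), ∑ e ∈ (internalDarts G).filter (fun e => m e = j),
          (N : ℚ) * (m e / 2 ^ m e) := by
        refine (sum_fiberwise_of_maps_to (fun e _ => ?_) _).symm
        exact mem_range.2 (Nat.lt_succ_of_le (card_le_univ _))
    _ = ∑ j ∈ range (Fintype.card V + 1), (((internalDarts G).filter (fun e => m e = j)).card : ℚ) *
          ((N : ℚ) * (j / 2 ^ j)) := by
        refine sum_congr rfl fun j _ => ?_
        rw [← nsmul_eq_mul, ← sum_const]
        refine sum_congr rfl fun e he => ?_
        rw [(mem_filter.1 he).2]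
    _ ≤ ∑ j ∈ range (Fintype.card V + 1), (2 * numTwigs G : ℚ) * ((N : ℚ) * (j / 2 ^ j)) := by
        refine sum_le_sum fun j _ => mul_le_mul_of_nonneg_right ?_ (by positivity)
        exact_mod_cast card_darts_le hG hdeg j
    _ = 2 * numTwigs G * N * ∑ j ∈ range (Fintype.card V + 1), (j : ℚ) / 2 ^ j := by
        rw [mul_sum]
        exact sum_congr rfl fun j _ => by ring
    _ ≤ 2 * numTwigs G * N * 2 := by
        refine mul_le_mul_of_nonneg_left ?_ (by positivity)
        rw [sum_range_div_two_pow, sub_le_self_iff]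
        positivity
    _ = _ := by ring

end Cut

section Count

variable {V : Type*} [Fintype V] {G : SimpleGraph V}

/-- The number of subtrees of `G` that contain `v`. -/
noncomputable def subtreeCountAt (G : SimpleGraph V) (v : V) : ℕ :=
  ((subtreeFinset G).filter fun S => v ∈ S).card

theorem isSubtree_insert_leaf_iff (hG : G.IsTree) {v w : V} (hv : G.degree v = 1)
    (hvw : G.Adj v w) {S : Finset V} (hw : w ∈ S) (hvS : v ∉ S) :
    G.IsSubtree (insert v S) ↔ G.IsSubtree S := by
  constructor <;> intro h
  · refine isSubtree_of_forall_exists_parent hw fun z hz hzw => ?_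
    obtain ⟨p, hp, hd⟩ := exists_parent hG hzw
    refine ⟨p, ?_, hp, hd⟩
    rcases mem_insert.1
      (h.parent_mem hG (mem_insert_of_mem hw) (mem_insert_of_mem hz) hp hd) with rfl | h
    · exact absurd (eq_of_adj_leaf hv hp hvw) hzw
    · exact h
  · refine isSubtree_of_forall_exists_parent (mem_insert_of_mem hw) fun z hz hzw => ?_
    rcases mem_insert.1 hz with rfl | hz
    · exact ⟨w, mem_insert_of_mem hw, hvw.symm, by rw [dist_self, dist_eq_one_iff_adj.2 hvw.symm]⟩
    · obtain ⟨p, hp, hd⟩ := exists_parent hG hzw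
      exact ⟨p, mem_insert_of_mem (h.parent_mem hG hw hz hp hd), hp, hd⟩

theorem two_mul_subtreeCountAt_leaf (hG : G.IsTree) {v w : V} (hv : G.degree v = 1)
    (hvw : G.Adj v w) : 2 * subtreeCountAt G v = subtreeCountAt G w + 2 := by
  set A := (subtreeFinset G).filter fun S => v ∈ S ∧ w ∈ S with hA
  set B := (subtreeFinset G).filter fun S => v ∉ S ∧ w ∈ S with hB
  have h1 : (subtreeFinset G).filter (fun S => v ∈ S) = insert {v} A := by
    ext S
    simp only [hA, mem_insert, mem_filter, mem_subtreeFinset]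
    constructor
    · rintro ⟨hS, hvS⟩
      by_cases hwS : w ∈ S
      · exact Or.inr ⟨hS, hvS, hwS⟩
      · left
        rw [eq_singleton_iff_unique_mem]
        refine ⟨hvS, fun s hs => ?_⟩
        by_contra hsv
        obtain ⟨p, hp, hd⟩ := exists_parent hG (x := s) (z := v) fun h => hsv h.symm
        have hpS := hS.parent_mem hG hs hvS hp hd
        rw [eq_of_adj_leaf hv hp.symm hvw] at hpS
        exact hwS hpS
    · rintro (rfl | ⟨h1, h2, -⟩)
      · exact ⟨isSubtree_singleton v, mem_singleton_self v⟩
      · exact ⟨h1, h2⟩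
  have h2 : (subtreeFinset G).filter (fun S => w ∈ S) = A ∪ B := by
    ext S
    simp only [hA, hB, mem_union, mem_filter]
    tauto
  have h3 : A.card = B.card := by
    refine card_bij' (fun S _ => S.erase v) (fun S _ => insert v S) ?_ ?_ ?_ ?_
    · intro S hS
      simp only [hA, hB, mem_filter, mem_subtreeFinset] at hS ⊢
      have hw : w ∈ S.erase v := mem_erase.2 ⟨hvw.ne', hS.2.2⟩
      refine ⟨?_, notMem_erase _ _, hw⟩
      rw [← isSubtree_insert_leaf_iff hG hv hvw hw (notMem_erase _ _), insert_erase hS.2.1]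
      exact hS.1
    · intro S hS
      simp only [hA, hB, mem_filter, mem_subtreeFinset] at hS ⊢
      exact ⟨(isSubtree_insert_leaf_iff hG hv hvw hS.2.2 hS.2.1).2 hS.1, mem_insert_self _ _,
        mem_insert_of_mem hS.2.2⟩
    · intro S hS
      exact insert_erase (mem_filter.1 hS).2.1
    · intro S hS
      exact erase_insert (mem_filter.1 hS).2.1
  have h4 : Disjoint A B := by
    rw [Finset.disjoint_left]
    intro S hS hS'
    exact (mem_filter.1 hS').2.1 (mem_filter.1 hS).2.1
  have h5 : ({v} : Finset V) ∉ A := fun h =>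
    hvw.ne' (mem_singleton.1 (mem_filter.1 h).2.2)
  unfold subtreeCountAt
  rw [h1, h2, card_insert_of_notMem h5, card_union_of_disjoint h4]
  omega

theorem sum_subtreeCountAt (s : Finset V) :
    ∑ v ∈ s, subtreeCountAt G v = ∑ S ∈ subtreeFinset G, (s ∩ S).card := by
  simp only [subtreeCountAt, card_filter, card_eq_sum_ones (_ ∩ _)]
  rw [sum_comm]
  refine sum_congr rfl fun S _ => ?_
  rw [← sum_filter]
  congr 1

theorem subtreeCountAt_le (v : V) : subtreeCountAt G v ≤ (subtreeFinset G).card :=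
  card_filter_le _ _

theorem sum_internal_sub_le (hG : G.IsTree) (hdeg : ∀ v, G.degree v = 1 ∨ 3 ≤ G.degree v) :
    ∑ v ∈ internalFinset G, ((subtreeFinset G).card - subtreeCountAt G v : ℚ) ≤
      4 * numTwigs G * (subtreeFinset G).card + Fintype.card V * numLeaves G := by
  have h1 : ∑ v ∈ internalFinset G, ((subtreeFinset G).card - subtreeCountAt G v : ℚ) =
      ∑ S ∈ subtreeFinset G, ((internalFinset G \ S).card : ℚ) := by
    have h2 : ∀ S : Finset V, ((internalFinset G \ S).card : ℚ) =
        (internalFinset G).card - (internalFinset G ∩ S).card := fun S => by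
      rw [← card_inter_add_card_sdiff (internalFinset G) S]
      push_cast
      ring
    rw [sum_congr rfl fun S _ => h2 S, sum_sub_distrib, sum_sub_distrib, sum_const, sum_const,
      nsmul_eq_mul, nsmul_eq_mul, mul_comm]
    congr 1
    exact_mod_cast sum_subtreeCountAt (internalFinset G)
  rw [h1, ← sum_filter_add_sum_filter_not _ fun S => ∀ a, G.degree a = 1 → S ≠ {a}]
  refine add_le_add (sum_card_internal_sdiff_le hG hdeg) ?_
  refine (sum_le_card_nsmul _ _ (Fintype.card V : ℚ) fun S _ => ?_).trans ?_
  · exact_mod_cast card_le_univ _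
  · rw [nsmul_eq_mul, mul_comm]
    refine mul_le_mul_of_nonneg_left ?_ (by positivity)
    have h3 : (subtreeFinset G).filter (fun S => ¬ ∀ a, G.degree a = 1 → S ≠ {a}) ⊆
        (leafFinset G).image fun a => {a} := by
      intro S hS
      have := (mem_filter.1 hS).2
      push Not at this
      obtain ⟨a, ha, rfl⟩ := this
      exact mem_image.2 ⟨a, mem_leafFinset.2 ha, rfl⟩
    exact_mod_cast (card_le_card h3).trans card_image_le

theorem sum_degree_internal (hG : G.IsTree) :
    ∑ v ∈ internalFinset G, G.degree v + numLeaves G + 2 = 2 * Fintype.card V := by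
  have h1 := G.sum_degrees_eq_twice_card_edges
  have h2 := hG.card_edgeFinset
  rw [← sum_filter_add_sum_filter_not univ fun v => G.degree v = 1] at h1
  have h3 : ∑ v ∈ univ.filter (fun v => G.degree v = 1), G.degree v = numLeaves G := by
    rw [sum_congr rfl fun v hv => (mem_filter.1 hv).2, sum_const, smul_eq_mul, mul_one]
    rfl
  have h4 : ∑ v ∈ internalFinset G, G.degree v =
    ∑ v ∈ univ.filter (fun v => ¬ G.degree v = 1), G.degree v := rfl
  omega

theorem numLeaves_add_card_internal :
    numLeaves G + (internalFinset G).card = Fintype.card V :=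
  card_filter_add_card_filter_not _

theorem neighbor_leaf_internal (hG : G.IsTree) (hI : (internalFinset G).Nonempty) {v w : V}
    (hv : G.degree v = 1) (hvw : G.Adj v w) : w ∈ internalFinset G := by
  rw [mem_internalFinset]
  intro hw
  obtain ⟨u, hu⟩ := hI
  rw [mem_internalFinset] at hu
  wlog h : G.dist u v = G.dist u w + 1 generalizing v w
  · exact this hw hvw.symm hv
      ((hG.dist_eq_dist_add_one_of_adj u hvw).resolve_left h)
  · obtain ⟨p, hp, hd⟩ := exists_parent hG (x := u) (z := w) (by rintro rfl; exact hu hw)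
    have := eq_of_adj_leaf hw hp.symm hvw.symm
    subst this
    omega

theorem two_pow_numLeaves_le (hG : G.IsTree) (hI : (internalFinset G).Nonempty) :
    2 ^ numLeaves G ≤ (subtreeFinset G).card := by
  rw [show numLeaves G = (leafFinset G).card from rfl, ← card_powerset]
  refine card_le_card_of_injOn (fun L => internalFinset G ∪ L) ?_ ?_
  · intro L _
    rw [mem_coe, mem_subtreeFinset]
    obtain ⟨u, hu⟩ := hI
    refine isSubtree_of_forall_exists_parent (mem_union_left _ hu) fun z _ hzu => ?_
    obtain ⟨p, hp, hd⟩ := exists_parent hG hzu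
    refine ⟨p, mem_union_left _ (mem_internalFinset.2 fun h => ?_), hp, hd⟩
    obtain ⟨q, hq, hqd⟩ := exists_parent hG (x := u) (z := p) (by
      rintro rfl; exact mem_internalFinset.1 hu h)
    have := eq_of_adj_leaf h hp hq.symm
    subst this
    omega
  · intro L hL L' hL' heq
    simp only [coe_powerset, Set.mem_preimage, Set.mem_powerset_iff] at hL hL' heq
    ext a
    have h1 : a ∈ internalFinset G ∪ L ↔ a ∈ internalFinset G ∪ L' := by rw [heq]
    simp only [mem_union, mem_internalFinset] at h1
    have h2 : a ∈ L → G.degree a = 1 := fun h => mem_leafFinset.1 (hL h)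
    have h3 : a ∈ L' → G.degree a = 1 := fun h => mem_leafFinset.1 (hL' h)
    tauto

theorem isSubtree_sdiff_twig (hG : G.IsTree) {v : V} (hv : IsTwig G v) {S B : Finset V}
    (hB : B = insert v ((G.neighborFinset v).filter fun u => G.degree u = 1))
    (hS : G.IsSubtree S) (hne : (S \ B).Nonempty) : G.IsSubtree (S \ B) := by
  obtain ⟨x, hx⟩ := hne
  refine isSubtree_of_forall_exists_parent hx fun z hz hzx => ?_
  obtain ⟨hxS, hxB⟩ := Finset.mem_sdiff.1 hx
  obtain ⟨hzS, hzB⟩ := Finset.mem_sdiff.1 hz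
  obtain ⟨p, hp, hd⟩ := exists_parent hG hzx
  refine ⟨p, Finset.mem_sdiff.2 ⟨hS.parent_mem hG hxS hzS hp hd, fun hpB => ?_⟩, hp, hd⟩
  have leaf : ∀ {a b}, G.degree a = 1 → a ∈ B → G.Adj a b → G.dist x b = G.dist x a + 1 → False := by
    intro a b ha haB hab hd
    obtain ⟨q, hq, hqd⟩ := exists_parent hG (x := x) (z := a) (by rintro rfl; exact hxB haB)
    have := eq_of_adj_leaf ha hab hq.symm
    subst this
    omega
  have hpB' := hpB
  rw [hB, mem_insert, mem_filter, mem_neighborFinset] at hpB'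
  rcases hpB' with rfl | ⟨-, h⟩
  · obtain ⟨q, hq, hqd⟩ := exists_parent hG (x := x) (z := p) (by rintro rfl; exact hxB hpB)
    by_cases hql : G.degree q = 1
    · refine leaf hql ?_ hq hqd
      rw [hB]
      exact mem_insert_of_mem (mem_filter.2 ⟨by simpa using hq.symm, hql⟩)
    · have hzl : G.degree z ≠ 1 := fun h => hzB (by
        rw [hB]
        exact mem_insert_of_mem (mem_filter.2 ⟨by simpa using hp, h⟩))
      have hqz : q ≠ z := by
        rintro rfl
        omega
      have h1 : ({q, z} : Finset V) ⊆ (G.neighborFinset p).filter fun u => ¬ G.degree u = 1 := by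
        intro a ha
        rw [mem_insert, mem_singleton] at ha
        rw [mem_filter, mem_neighborFinset]
        rcases ha with rfl | rfl
        · exact ⟨hq.symm, hql⟩
        · exact ⟨hp, hzl⟩
      have h2 := card_le_card h1
      rw [card_pair hqz] at h2
      have h3 := card_filter_add_card_filter_not (s := G.neighborFinset p) (fun u => G.degree u = 1)
      rw [card_neighborFinset_eq_degree] at h3
      have h4 := hv.2
      have h5 := hv.1
      omega
  · exact leaf h hpB hp hd

theorem card_subtreeFinset_le_of_twig (hG : G.IsTree) {v : V} (hv : IsTwig G v)
    (h3 : G.degree v = 3) :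
    (subtreeFinset G).card ≤ 32 * ((subtreeFinset G).card - subtreeCountAt G v) := by
  set A := (subtreeFinset G).filter fun S => v ∉ S with hA
  set B := insert v ((G.neighborFinset v).filter fun u => G.degree u = 1) with hB
  have hAcard : (subtreeFinset G).card - subtreeCountAt G v = A.card := by
    have h : subtreeCountAt G v + A.card = (subtreeFinset G).card := by
      convert card_filter_add_card_filter_not (s := subtreeFinset G) (fun S => v ∈ S)
      rfl
    omega
  have hBcard : B.card ≤ 4 := by
    have h := card_filter_le (G.neighborFinset v) (fun u => G.degree u = 1)
    rw [card_neighborFinset_eq_degree, h3] at h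
    exact (card_insert_le _ _).trans (Nat.add_le_add_right h 1)
  have hApos : 1 ≤ A.card := by
    obtain ⟨u, hu⟩ := (G.degree_pos_iff_exists_adj v).1 (by omega)
    exact card_pos.2 ⟨{u}, mem_filter.2 ⟨mem_subtreeFinset.2 (isSubtree_singleton u),
      fun h => hu.ne (mem_singleton.1 h)⟩⟩
  have h1 : (subtreeFinset G).card ≤ (B.powerset ×ˢ insert ∅ A).card := by
    refine card_le_card_of_injOn (fun S => (S ∩ B, S \ B)) ?_ ?_
    · intro S hS
      rw [mem_coe, mem_subtreeFinset] at hS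
      rw [mem_coe, mem_product, mem_powerset, mem_insert]
      refine ⟨inter_subset_right, (S \ B).eq_empty_or_nonempty.imp_right fun hne => ?_⟩
      refine mem_filter.2 ⟨mem_subtreeFinset.2 (isSubtree_sdiff_twig hG hv hB hS hne), fun h => ?_⟩
      exact (Finset.mem_sdiff.1 h).2 (mem_insert_self _ _)
    · intro S _ S' _ heq
      rw [Prod.mk.injEq] at heq
      rw [← sdiff_union_inter S B, ← sdiff_union_inter S' B, heq.1, heq.2]
  rw [card_product, card_powerset] at h1
  have h2 := card_insert_le (∅ : Finset V) A
  have h4 : 2 ^ B.card ≤ 2 ^ 4 := Nat.pow_le_pow_right two_pos hBcard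
  have h5 := h1.trans (Nat.mul_le_mul h4 h2)
  rw [hAcard]
  omega

end Count

section Density

variable {V : Type*} [Fintype V] {G : SimpleGraph V}

theorem InT3.degree_eq_one_or (hT : InT3 G) (v : V) : G.degree v = 1 ∨ 3 ≤ G.degree v := by
  obtain ⟨hG, ⟨u, hu⟩, h⟩ := hT
  obtain ⟨w, hw⟩ := (G.degree_pos_iff_exists_adj u).1 (by omega)
  have : Nontrivial V := ⟨u, w, hw.ne⟩
  have := hG.connected.preconnected.degree_pos_of_nontrivial v
  have := h v
  omega

theorem InT3.internalFinset_nonempty (hT : InT3 G) : (internalFinset G).Nonempty := by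
  obtain ⟨u, hu⟩ := hT.2.1
  exact ⟨u, mem_internalFinset.2 (by omega)⟩

theorem InT3.card_add_two_le (hT : InT3 G) : Fintype.card V + 2 ≤ 2 * numLeaves G := by
  have h1 := sum_degree_internal hT.1
  have h2 := numLeaves_add_card_internal (G := G)
  have h3 : ∑ v ∈ internalFinset G, 3 ≤ ∑ v ∈ internalFinset G, G.degree v :=
    sum_le_sum fun v hv => (hT.degree_eq_one_or v).resolve_left (mem_internalFinset.1 hv)
  rw [sum_const, smul_eq_mul] at h3
  omega

theorem sq_le_two_mul_two_pow (l : ℕ) : l * l ≤ 2 * 2 ^ l := by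
  induction l with
  | zero => norm_num
  | succ l ih =>
    rcases lt_or_ge l 3 with h | h
    · interval_cases l <;> norm_num
    · rw [pow_succ]
      nlinarith

theorem InT3.card_mul_numLeaves_le (hT : InT3 G) :
    Fintype.card V * numLeaves G ≤ 4 * (subtreeFinset G).card := by
  have h1 := hT.card_add_two_le
  have h2 := sq_le_two_mul_two_pow (numLeaves G)
  have h3 := two_pow_numLeaves_le hT.1 hT.internalFinset_nonempty
  nlinarith

theorem InT3.card_pos (hT : InT3 G) : 0 < Fintype.card V :=
  Fintype.card_pos_iff.2 hT.1.connected.nonempty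

theorem InT3.subtreeFinset_card_pos (hT : InT3 G) : 0 < (subtreeFinset G).card :=
  (Nat.pow_pos two_pos).trans_le (two_pow_numLeaves_le hT.1 hT.internalFinset_nonempty)

theorem two_mul_sum_card (hG : G.IsTree) {f : V → V}
    (hf : ∀ v ∈ leafFinset G, G.Adj v (f v)) :
    2 * ∑ S ∈ subtreeFinset G, S.card = 2 * ∑ v ∈ internalFinset G, subtreeCountAt G v +
      ∑ v ∈ leafFinset G, subtreeCountAt G (f v) + 2 * numLeaves G := by
  have h1 := sum_subtreeCountAt (G := G) univ
  simp only [univ_inter] at h1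
  have h2 : ∑ v ∈ leafFinset G, subtreeCountAt G v + ∑ v ∈ internalFinset G, subtreeCountAt G v =
      ∑ v, subtreeCountAt G v :=
    sum_filter_add_sum_filter_not _ _ _
  have h3 : ∑ v ∈ leafFinset G, 2 * subtreeCountAt G v =
      ∑ v ∈ leafFinset G, (subtreeCountAt G (f v) + 2) :=
    sum_congr rfl fun v hv => two_mul_subtreeCountAt_leaf hG (mem_leafFinset.1 hv) (hf v hv)
  rw [sum_add_distrib, sum_const, smul_eq_mul, ← mul_sum] at h3
  have h4 : numLeaves G = (leafFinset G).card := rfl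
  omega

theorem InT3.exists_leaf_neighbor (hT : InT3 G) :
    ∃ f : V → V, ∀ v ∈ leafFinset G, G.Adj v (f v) ∧ f v ∈ internalFinset G := by
  have : Nonempty V := hT.1.connected.nonempty
  choose! f hf using fun v (hv : v ∈ leafFinset G) =>
    (G.degree_pos_iff_exists_adj v).1 (by rw [mem_leafFinset.1 hv]; exact one_pos)
  exact ⟨f, fun v hv => ⟨hf v hv, neighbor_leaf_internal hT.1 hT.internalFinset_nonempty
    (mem_leafFinset.1 hv) (hf v hv)⟩⟩

theorem InT3.sum_degree_sub_three (hT : InT3 G) :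
    ∑ v ∈ internalFinset G, (G.degree v - 3 : ℚ) = 2 * numLeaves G - Fintype.card V - 2 := by
  have h1 := sum_degree_internal hT.1
  have h2 := numLeaves_add_card_internal (G := G)
  rw [sum_sub_distrib, sum_const, nsmul_eq_mul]
  have h3 : (∑ v ∈ internalFinset G, (G.degree v : ℚ)) + numLeaves G + 2 =
    2 * Fintype.card V := by exact_mod_cast h1
  have h4 : (numLeaves G : ℚ) + (internalFinset G).card = Fintype.card V := by exact_mod_cast h2
  linarith

theorem InT3.three_le_degree_cast (hT : InT3 G) {v : V} (hv : v ∈ internalFinset G) :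
    (3 : ℚ) ≤ G.degree v := by
  exact_mod_cast (hT.degree_eq_one_or v).resolve_left (mem_internalFinset.1 hv)

theorem sub_subtreeCountAt_nonneg (v : V) :
    (0 : ℚ) ≤ (subtreeFinset G).card - subtreeCountAt G v :=
  sub_nonneg.2 (by exact_mod_cast subtreeCountAt_le v)

theorem InT3.numTwigs_mul_le (hT : InT3 G) :
    (numTwigs G - (2 * numLeaves G - Fintype.card V) : ℚ) * (subtreeFinset G).card ≤
      32 * ∑ v ∈ internalFinset G, ((subtreeFinset G).card - subtreeCountAt G v : ℚ) := by
  set N := (subtreeFinset G).card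
  have h1 : ∀ v ∈ internalFinset G,
      ((if IsTwig G v then 1 else 0) - (G.degree v - 3) : ℚ) * N ≤
        32 * (N - subtreeCountAt G v : ℚ) := by
    intro v hv
    have hd := hT.three_le_degree_cast hv
    have h0 := sub_subtreeCountAt_nonneg (G := G) v
    have hN : (0 : ℚ) ≤ N := Nat.cast_nonneg _
    by_cases h : IsTwig G v ∧ G.degree v = 3
    · have h2 := card_subtreeFinset_le_of_twig hT.1 h.1 h.2
      have h3 : (N : ℚ) ≤ 32 * (N - subtreeCountAt G v : ℚ) := by
        rw [← Nat.cast_sub (subtreeCountAt_le v)]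
        exact_mod_cast h2
      rw [if_pos h.1, h.2]
      norm_num
      linarith
    · refine le_trans (mul_nonpos_of_nonpos_of_nonneg ?_ hN) (by linarith)
      split_ifs with ht
      · have h3 : G.degree v ≠ 3 := fun h' => h ⟨ht, h'⟩
        have h4 : 4 ≤ G.degree v := by
          have := (hT.degree_eq_one_or v).resolve_left (mem_internalFinset.1 hv)
          omega
        have h5 : (4 : ℚ) ≤ G.degree v := by exact_mod_cast h4
        linarith
      · linarith
  have h2 := sum_le_sum h1
  rw [← sum_mul, ← mul_sum, sum_sub_distrib, hT.sum_degree_sub_three, ← sum_filter, sum_const,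
    nsmul_eq_mul, mul_one] at h2
  have h3 : (internalFinset G).filter (IsTwig G) = univ.filter fun v => IsTwig G v := by
    ext v
    simp only [mem_filter, mem_internalFinset, mem_univ, true_and, and_iff_right_iff_imp]
    intro h
    have := h.1
    omega
  rw [h3] at h2
  change ((numTwigs G : ℚ) - _) * _ ≤ _ at h2
  nlinarith [(Nat.cast_nonneg N : (0 : ℚ) ≤ N)]

theorem InT3.sum_leaf_sub_le (hT : InT3 G) {f : V → V}
    (hf : ∀ v ∈ leafFinset G, G.Adj v (f v) ∧ f v ∈ internalFinset G) :
    ∑ v ∈ leafFinset G, ((subtreeFinset G).card - subtreeCountAt G (f v) : ℚ) ≤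
      3 * ∑ v ∈ internalFinset G, ((subtreeFinset G).card - subtreeCountAt G v : ℚ) +
        (2 * numLeaves G - Fintype.card V) * (subtreeFinset G).card := by
  set N := (subtreeFinset G).card
  calc _ = ∑ w ∈ internalFinset G, ∑ v ∈ (leafFinset G).filter (fun v => f v = w),
        (N - subtreeCountAt G (f v) : ℚ) :=
        (sum_fiberwise_of_maps_to (fun v hv => (hf v hv).2) _).symm
    _ = ∑ w ∈ internalFinset G, (((leafFinset G).filter (fun v => f v = w)).card : ℚ) *
        (N - subtreeCountAt G w : ℚ) := by
        refine sum_congr rfl fun w _ => ?_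
        rw [← nsmul_eq_mul, ← sum_const]
        exact sum_congr rfl fun v hv => by rw [(mem_filter.1 hv).2]
    _ ≤ ∑ w ∈ internalFinset G, (3 * (N - subtreeCountAt G w : ℚ) + (G.degree w - 3) * N) := by
        refine sum_le_sum fun w hw => ?_
        have h1 : (leafFinset G).filter (fun v => f v = w) ⊆ G.neighborFinset w := by
          intro v hv
          obtain ⟨hvL, rfl⟩ := mem_filter.1 hv
          rw [mem_neighborFinset]
          exact (hf v hvL).1.symm
        have h2 := card_le_card h1
        rw [card_neighborFinset_eq_degree] at h2
        have h3 : (((leafFinset G).filter (fun v => f v = w)).card : ℚ) ≤ G.degree w := by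
          exact_mod_cast h2
        have h4 := sub_subtreeCountAt_nonneg (G := G) w
        have h5 := hT.three_le_degree_cast hw
        have h6 : (0 : ℚ) ≤ subtreeCountAt G w := Nat.cast_nonneg _
        nlinarith [mul_le_mul_of_nonneg_right h3 h4, mul_nonneg (sub_nonneg.2 h5) h6]
    _ = 3 * ∑ v ∈ internalFinset G, (N - subtreeCountAt G v : ℚ) +
        (2 * numLeaves G - Fintype.card V - 2) * N := by
        rw [sum_add_distrib, ← mul_sum, ← sum_mul, hT.sum_degree_sub_three]
    _ ≤ _ := by
        nlinarith [(Nat.cast_nonneg N : (0 : ℚ) ≤ N)]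

theorem InT3.two_mul_sum_card_eq (hT : InT3 G) {f : V → V}
    (hf : ∀ v ∈ leafFinset G, G.Adj v (f v) ∧ f v ∈ internalFinset G) :
    2 * ∑ S ∈ subtreeFinset G, (S.card : ℚ) =
      (2 * Fintype.card V - numLeaves G) * (subtreeFinset G).card -
      2 * ∑ v ∈ internalFinset G, ((subtreeFinset G).card - subtreeCountAt G v : ℚ) -
      ∑ v ∈ leafFinset G, ((subtreeFinset G).card - subtreeCountAt G (f v) : ℚ) +
      2 * numLeaves G := by
  have h1 := two_mul_sum_card hT.1 fun v hv => (hf v hv).1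
  have h2 : 2 * ∑ S ∈ subtreeFinset G, (S.card : ℚ) =
      2 * ∑ v ∈ internalFinset G, (subtreeCountAt G v : ℚ) +
      ∑ v ∈ leafFinset G, (subtreeCountAt G (f v) : ℚ) + 2 * numLeaves G := by exact_mod_cast h1
  have h3 : (numLeaves G : ℚ) + (internalFinset G).card = Fintype.card V := by
    exact_mod_cast numLeaves_add_card_internal (G := G)
  have h4 : ((leafFinset G).card : ℚ) = numLeaves G := rfl
  rw [h2, sum_sub_distrib, sum_sub_distrib, sum_const, sum_const, nsmul_eq_mul, nsmul_eq_mul, h4,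
    ← h3]
  ring

theorem InT3.density_le (hT : InT3 G) :
    mu G / Fintype.card V ≤ 1 - numLeaves G / (Fintype.card V : ℚ) / 2 -
      (numTwigs G / (Fintype.card V : ℚ) - (2 * (numLeaves G / (Fintype.card V : ℚ)) - 1)) / 32 +
      4 * (1 / (Fintype.card V : ℚ)) := by
  obtain ⟨f, hf⟩ := hT.exists_leaf_neighbor
  have h1 := hT.two_mul_sum_card_eq hf
  have h2 : 0 ≤ ∑ v ∈ leafFinset G, ((subtreeFinset G).card - subtreeCountAt G (f v) : ℚ) :=
    sum_nonneg fun v _ => sub_subtreeCountAt_nonneg _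
  have h3 := hT.numTwigs_mul_le
  have h4 : (Fintype.card V * numLeaves G : ℚ) ≤ 4 * (subtreeFinset G).card := by
    exact_mod_cast hT.card_mul_numLeaves_le
  have hn : (1 : ℚ) ≤ Fintype.card V := by exact_mod_cast hT.card_pos
  have hN : (0 : ℚ) < (subtreeFinset G).card := by exact_mod_cast hT.subtreeFinset_card_pos
  have hl : (0 : ℚ) ≤ numLeaves G := Nat.cast_nonneg _
  have h5 : (numLeaves G : ℚ) ≤ 4 * (subtreeFinset G).card := by nlinarith
  rw [mu, div_div, div_le_iff₀ (by positivity)]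
  field_simp
  linarith

theorem InT3.density_le_of_numLeaves (hT : InT3 G) :
    mu G / Fintype.card V ≤ 1 - numLeaves G / (Fintype.card V : ℚ) / 2 +
      4 * (1 / (Fintype.card V : ℚ)) := by
  obtain ⟨f, hf⟩ := hT.exists_leaf_neighbor
  have h1 := hT.two_mul_sum_card_eq hf
  have h2 : 0 ≤ ∑ v ∈ leafFinset G, ((subtreeFinset G).card - subtreeCountAt G (f v) : ℚ) :=
    sum_nonneg fun v _ => sub_subtreeCountAt_nonneg _
  have h3 : 0 ≤ ∑ v ∈ internalFinset G, ((subtreeFinset G).card - subtreeCountAt G v : ℚ) :=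
    sum_nonneg fun v _ => sub_subtreeCountAt_nonneg _
  have h4 : (Fintype.card V * numLeaves G : ℚ) ≤ 4 * (subtreeFinset G).card := by
    exact_mod_cast hT.card_mul_numLeaves_le
  have hn : (1 : ℚ) ≤ Fintype.card V := by exact_mod_cast hT.card_pos
  have hN : (0 : ℚ) < (subtreeFinset G).card := by exact_mod_cast hT.subtreeFinset_card_pos
  have hl : (0 : ℚ) ≤ numLeaves G := Nat.cast_nonneg _
  have h5 : (numLeaves G : ℚ) ≤ 4 * (subtreeFinset G).card := by nlinarith
  rw [mu, div_div, div_le_iff₀ (by positivity)]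
  field_simp
  linarith

theorem InT3.le_density (hT : InT3 G) :
    1 - numLeaves G / (Fintype.card V : ℚ) / 2 - 10 * (numTwigs G / (Fintype.card V : ℚ)) -
      10 * (1 / (Fintype.card V : ℚ)) - (numLeaves G / (Fintype.card V : ℚ) - 1 / 2) ≤
      mu G / Fintype.card V := by
  obtain ⟨f, hf⟩ := hT.exists_leaf_neighbor
  have h1 := hT.two_mul_sum_card_eq hf
  have h2 := hT.sum_leaf_sub_le hf
  have h3 := sum_internal_sub_le hT.1 hT.degree_eq_one_or
  have h4 : (Fintype.card V * numLeaves G : ℚ) ≤ 4 * (subtreeFinset G).card := by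
    exact_mod_cast hT.card_mul_numLeaves_le
  have hn : (1 : ℚ) ≤ Fintype.card V := by exact_mod_cast hT.card_pos
  have hN : (0 : ℚ) < (subtreeFinset G).card := by exact_mod_cast hT.subtreeFinset_card_pos
  rw [mu, div_div, le_div_iff₀ (by positivity)]
  field_simp
  linarith

end Density

theorem tendsto_card_of_pairwise_not_iso {V : ℕ → Type} [∀ i, Fintype (V i)]
    {G : ∀ i, SimpleGraph (V i)} (hdist : ∀ i j, i ≠ j → IsEmpty (G i ≃g G j)) :
    Tendsto (fun i => Fintype.card (V i)) atTop atTop := by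
  refine tendsto_atTop.2 fun K => ?_
  rw [← Nat.cofinite_eq_atTop, eventually_cofinite]
  let F : {i | ¬ K ≤ Fintype.card (V i)} → Σ k : Fin K, SimpleGraph (Fin k) := fun i =>
    ⟨⟨Fintype.card (V i), not_le.1 i.2⟩, (G i).comap (Fintype.equivFin (V i)).symm⟩
  have hiso : ∀ a b : Σ k : Fin K, SimpleGraph (Fin k), a = b → Nonempty (a.2 ≃g b.2) := by
    rintro a _ rfl
    exact ⟨Iso.refl⟩
  have hF : Function.Injective F := by
    intro i j hij
    by_contra hne
    obtain ⟨e⟩ := hiso _ _ hij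
    exact (hdist i j fun h => hne (Subtype.ext h)).false
      (((Iso.comap (Fintype.equivFin (V i)).symm (G i)).symm.trans e).trans
        (Iso.comap (Fintype.equivFin (V j)).symm (G j)))
  have := Finite.of_injective F hF
  exact Set.toFinite _

/-- A sequence of pairwise non-isomorphic trees in 𝒯₃ has average subtree density
tending to `3/4` if and only if the proportion of leaves tends to `1/2` and the
proportion of twigs tends to `0`. -/
theorem density_tendsto_three_quarters_iff (V : ℕ → Type) [∀ i, Fintype (V i)]
    (G : ∀ i, SimpleGraph (V i)) (hT : ∀ i, InT3 (G i))
    (hdist : ∀ i j, i ≠ j → IsEmpty (G i ≃g G j)) :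
    Filter.Tendsto (fun i => mu (G i) / (Fintype.card (V i) : ℚ))
        Filter.atTop (nhds (3 / 4)) ↔
      (Filter.Tendsto (fun i => (numLeaves (G i) : ℚ) / (Fintype.card (V i) : ℚ))
          Filter.atTop (nhds (1 / 2)) ∧
        Filter.Tendsto (fun i => (numTwigs (G i) : ℚ) / (Fintype.card (V i) : ℚ))
          Filter.atTop (nhds 0)) := by
  have hε : Tendsto (fun i => 1 / (Fintype.card (V i) : ℚ)) atTop (nhds 0) :=
    (tendsto_const_nhds.div_atTop
      (tendsto_natCast_atTop_atTop.comp (tendsto_card_of_pairwise_not_iso hdist)))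
  have hhalf : ∀ i, 1 / 2 ≤ (numLeaves (G i) : ℚ) / (Fintype.card (V i) : ℚ) := fun i => by
    have h1 : (Fintype.card (V i) : ℚ) + 2 ≤ 2 * numLeaves (G i) := by
      exact_mod_cast (hT i).card_add_two_le
    have h2 : (0 : ℚ) < Fintype.card (V i) := by exact_mod_cast (hT i).card_pos
    rw [le_div_iff₀ h2]
    linarith
  constructor
  · intro hD
    have hx : Tendsto (fun i => (numLeaves (G i) : ℚ) / (Fintype.card (V i) : ℚ))
        atTop (nhds (1 / 2)) := by
      have hlim := ((hε.const_mul 4).sub (hD.sub_const 1)).const_mul 2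
      refine tendsto_of_tendsto_of_tendsto_of_le_of_le tendsto_const_nhds
        (hlim.trans_eq (by norm_num)) hhalf fun i => ?_
      have := (hT i).density_le_of_numLeaves
      dsimp only
      linarith
    refine ⟨hx, ?_⟩
    have hlim := (((hε.const_mul 4).sub (hD.sub_const 1)).const_mul 32).sub
      ((hx.const_mul 14).add_const 1)
    refine tendsto_of_tendsto_of_tendsto_of_le_of_le tendsto_const_nhds
      (hlim.trans_eq (by norm_num)) (fun i => by positivity) fun i => ?_
    have := (hT i).density_le
    dsimp only
    linarith
  · rintro ⟨hx, ht⟩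
    have hlow := (((hx.const_mul (-3 / 2)).add_const (3 / 2)).sub (ht.const_mul 10)).sub
      (hε.const_mul 10)
    have hupp := ((hx.const_mul (-1 / 2)).add_const 1).add (hε.const_mul 4)
    refine tendsto_of_tendsto_of_tendsto_of_le_of_le (hlow.trans_eq (by norm_num))
      (hupp.trans_eq (by norm_num)) (fun i => ?_) fun i => ?_
    · have := (hT i).le_density
      dsimp only
      linarith
    · have := (hT i).density_le_of_numLeaves
      dsimp only
      linarith
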